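/- arXiv:1502.07060 — 4 statements merged into one kernel-verified Lean document; each statement's English description precedes it below -/
import Mathlib

section
/- Let C be a salient closed convex cone spanning a finite-dimensional real vector space V, and let N ≤ GL(V) be a finite subgroup with n(C) ⊆ C for every n ∈ N. Define π : V → V by π(v) = (1/|N|)·Σ_{n∈N} n(v), and let V' = {v ∈ V : n(v) = v for all n ∈ N} be the subspace of vectors fixed by N. Then π(C) = C ∩ V', the cone C' := C ∩ V' is a salient closed convex cone that spans V', and C' contains a vector lying in the topological interior of C in V. -/
/-- The averaging/reduction step in the proof of Lemma 3.6 of the paper.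
For a finite subgroup `N ≤ GL(V)` preserving a salient closed convex spanning
cone `C`, the averaging projection `π(v) = |N|⁻¹ ∑_{n ∈ N} n(v)` maps `C` onto
`C ∩ V'` where `V'` is the fixed subspace of `N`; the cone `C' = C ∩ V'` is a
salient closed convex cone spanning `V'`, and it contains an interior point
of `C`. -/
theorem stmt2 (V : Type*) [NormedAddCommGroup V] [NormedSpace ℝ V]
    [FiniteDimensional ℝ V] (C : Set V)
    (hC_closed : IsClosed C)
    (hC_add : ∀ x ∈ C, ∀ y ∈ C, x + y ∈ C)
    (hC_smul : ∀ t : ℝ, 0 ≤ t → ∀ x ∈ C, t • x ∈ C)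
    (hC_salient : C ∩ (-C) = {0})
    (hC_span : Submodule.span ℝ C = ⊤)
    (N : Subgroup (V ≃L[ℝ] V))
    (hN_fin : (N : Set (V ≃L[ℝ] V)).Finite)
    (hN_C : ∀ n ∈ N, ∀ x ∈ C, n x ∈ C)
    (π : V → V)
    (hπ : ∀ v : V, π v = (hN_fin.toFinset.card : ℝ)⁻¹ • ∑ n ∈ hN_fin.toFinset, n v)
    (V' : Set V) (hV' : V' = {v : V | ∀ n ∈ N, n v = v})
    (C' : Set V) (hC' : C' = C ∩ V') :
    π '' C = C ∩ V' ∧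
    IsClosed C' ∧
    (∀ x ∈ C', ∀ y ∈ C', x + y ∈ C') ∧
    (∀ t : ℝ, 0 ≤ t → ∀ x ∈ C', t • x ∈ C') ∧
    C' ∩ (-C') = {0} ∧
    (Submodule.span ℝ C' = Submodule.span ℝ V') ∧
    ∃ v ∈ C', v ∈ interior C := by
  subst hC'
  have hk : 0 < (hN_fin.toFinset.card : ℝ) := by
    have : (1 : V ≃L[ℝ] V) ∈ hN_fin.toFinset := by simpa using N.one_mem
    exact_mod_cast Finset.card_pos.mpr ⟨_, this⟩
  set k : ℝ := (hN_fin.toFinset.card : ℝ) with hkdef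
  have hCne : C.Nonempty := by
    have h0 : (0 : V) ∈ C ∩ (-C) := by rw [hC_salient]; rfl
    exact ⟨0, h0.1⟩
  have h0C : (0 : V) ∈ C := by
    obtain ⟨x, hx⟩ := hCne
    simpa using hC_smul 0 le_rfl x hx
  have hsum : ∀ (s : Finset (V ≃L[ℝ] V)), (∀ n ∈ s, n ∈ N) → ∀ x ∈ C, ∑ n ∈ s, n x ∈ C := by
    intro s hs x hx
    exact Finset.sum_induction _ (· ∈ C) (fun a b ha hb => hC_add a ha b hb) h0C
      (fun n hn => hN_C n (hs n hn) x hx)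
  have hmem : ∀ n, n ∈ hN_fin.toFinset ↔ n ∈ N := by intro n; simp
  have hπC : ∀ x ∈ C, π x ∈ C := by
    intro x hx
    rw [hπ]
    exact hC_smul _ (inv_nonneg.mpr hk.le) _ (hsum _ (fun n hn => (hmem n).1 hn) x hx)
  have hπV : ∀ x, π x ∈ V' := by
    intro x
    rw [hV', hπ]
    intro m hm
    rw [map_smul, map_sum]
    congr 1
    refine Finset.sum_nbij' (fun n => m * n) (fun n => m⁻¹ * n) ?_ ?_ ?_ ?_ ?_
    · intro n hn
      exact (hmem _).2 (N.mul_mem hm ((hmem n).1 hn))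
    · intro n hn
      exact (hmem _).2 (N.mul_mem (N.inv_mem hm) ((hmem n).1 hn))
    · intro n _; simp
    · intro n _; simp
    · intro n _; rfl
  have hπfix : ∀ x ∈ V', π x = x := by
    intro x hx
    rw [hV'] at hx
    rw [hπ, Finset.sum_congr rfl (fun n hn => hx n ((hmem n).1 hn)), Finset.sum_const,
      ← Nat.cast_smul_eq_nsmul ℝ, smul_smul, inv_mul_cancel₀ hk.ne', one_smul]
  have hVadd : ∀ x ∈ V', ∀ y ∈ V', x + y ∈ V' := by
    rw [hV']; intro x hx y hy n hn
    rw [map_add, hx n hn, hy n hn]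
  have hVsmul : ∀ t : ℝ, ∀ x ∈ V', t • x ∈ V' := by
    rw [hV']; intro t x hx n hn
    rw [map_smul, hx n hn]
  have hVcl : IsClosed V' := by
    have : V' = ⋂ n ∈ N, {v : V | n v = v} := by rw [hV']; ext v; simp
    rw [this]
    exact isClosed_biInter fun n _ => isClosed_eq n.continuous continuous_id
  have hconv : Convex ℝ C := by
    intro x hx y hy a b ha hb _
    exact hC_add _ (hC_smul a ha x hx) _ (hC_smul b hb y hy)
  have hint : (interior C).Nonempty := by
    rw [hconv.interior_nonempty_iff_affineSpan_eq_top,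
      AffineSubspace.affineSpan_eq_top_iff_vectorSpan_eq_top_of_nonempty ℝ V V hCne,
      vectorSpan_eq_span_vsub_set_right ℝ h0C]
    simpa using hC_span
  have hw : ∃ w ∈ C ∩ V', w ∈ interior C := by
    obtain ⟨v, hv⟩ := hint
    have hvC := interior_subset hv
    refine ⟨π v, ⟨hπC v hvC, hπV v⟩, ?_⟩
    classical
    set r : V := ∑ n ∈ hN_fin.toFinset.erase 1, n v with hr
    have hrC : r ∈ C :=
      hsum _ (fun n hn => (hmem n).1 (Finset.mem_of_mem_erase hn)) v hvC
    have hs : ∑ n ∈ hN_fin.toFinset, n v = v + r := by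
      rw [hr, ← Finset.add_sum_erase _ _ ((hmem 1).2 N.one_mem)]
      rfl
    rw [mem_interior]
    refine ⟨(fun x : V => k • x - r) ⁻¹' interior C, ?_, ?_, ?_⟩
    · intro x hx
      have h1 := hC_smul k⁻¹ (inv_nonneg.mpr hk.le) _ (hC_add _ (interior_subset hx) r hrC)
      simpa [smul_smul, inv_mul_cancel₀ hk.ne'] using h1
    · exact isOpen_interior.preimage (by fun_prop)
    · change k • π v - r ∈ interior C
      rw [hπ, hs, smul_smul, mul_inv_cancel₀ hk.ne', one_smul, add_sub_cancel_right]
      exact hv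
  refine ⟨?_, hC_closed.inter hVcl, ?_, ?_, ?_, ?_, hw⟩
  · ext x
    constructor
    · rintro ⟨y, hy, rfl⟩
      exact ⟨hπC y hy, hπV y⟩
    · rintro ⟨hx, hx'⟩
      exact ⟨x, hx, hπfix x hx'⟩
  · rintro x ⟨hx, hx'⟩ y ⟨hy, hy'⟩
    exact ⟨hC_add x hx y hy, hVadd x hx' y hy'⟩
  · rintro t ht x ⟨hx, hx'⟩
    exact ⟨hC_smul t ht x hx, hVsmul t x hx'⟩
  · have h0V : (0 : V) ∈ V' := by rw [hV']; intro n _; exact map_zero n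
    ext x
    constructor
    · rintro ⟨h1, h2⟩
      rw [← hC_salient]
      exact ⟨h1.1, h2.1⟩
    · rintro rfl
      exact ⟨⟨h0C, h0V⟩, by simpa using And.intro h0C h0V⟩
  · apply le_antisymm (Submodule.span_mono Set.inter_subset_right)
    rw [Submodule.span_le]
    intro v hv
    obtain ⟨w, hwC, hwi⟩ := hw
    have hc : Filter.Tendsto (fun t : ℝ => w + t • v) (nhdsWithin 0 (Set.Ioi 0)) (nhds w) := by
      have : Continuous (fun t : ℝ => w + t • v) := by fun_prop
      have h := this.tendsto 0
      simp only [zero_smul, add_zero] at h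
      exact h.mono_left nhdsWithin_le_nhds
    have hev := (hc.eventually (mem_interior_iff_mem_nhds.1 hwi)).and
      (self_mem_nhdsWithin : Set.Ioi (0 : ℝ) ∈ nhdsWithin 0 (Set.Ioi 0))
    obtain ⟨t, htC, ht⟩ := hev.exists
    have ht : (0 : ℝ) < t := ht
    have h1 : w + t • v ∈ Submodule.span ℝ (C ∩ V') :=
      Submodule.subset_span ⟨htC, hVadd _ hwC.2 _ (hVsmul t v hv)⟩
    have h2 := Submodule.smul_mem _ t⁻¹ (Submodule.sub_mem _ h1 (Submodule.subset_span hwC))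
    simpa [smul_smul, inv_mul_cancel₀ ht.ne'] using h2
end

section
/- Let C be a salient closed convex cone spanning a finite-dimensional real normed vector space V, and let L be a vector in the topological interior of C. Then there exists a constant c > 0 such that every ℝ-linear endomorphism T of V with T(C) ⊆ C satisfies ‖T‖ ≤ c·‖T(L)‖, where ‖T‖ denotes the operator norm. -/
theorem cone_normal_aux {V : Type*} [NormedAddCommGroup V] [NormedSpace ℝ V]
    [FiniteDimensional ℝ V] (C : Set V)
    (hC_closed : IsClosed C)
    (hC_smul : ∀ t : ℝ, 0 ≤ t → ∀ x ∈ C, t • x ∈ C)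
    (hC_salient : C ∩ (-C) = {0}) (h0 : (0 : V) ∈ C) :
    ∃ d : ℝ, 0 < d ∧ ∀ u ∈ C, ∀ v ∈ C, d * ‖u‖ ≤ ‖u + v‖ := by
  have : ProperSpace V := FiniteDimensional.proper ℝ V
  have hK : IsCompact (Metric.sphere (0 : V) 1 ∩ C) :=
    (isCompact_sphere (0 : V) 1).inter_right hC_closed
  have hne : (-C).Nonempty := ⟨0, by simpa using h0⟩
  obtain ⟨d, hd, hdK⟩ : ∃ d : ℝ, 0 < d ∧ ∀ u ∈ Metric.sphere (0 : V) 1 ∩ C,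
      d ≤ Metric.infDist u (-C) := by
    rcases (Metric.sphere (0 : V) 1 ∩ C).eq_empty_or_nonempty with h | h
    · exact ⟨1, one_pos, by simp [h]⟩
    · obtain ⟨u, hu, hmin⟩ := hK.exists_isMinOn h
        (Metric.continuous_infDist_pt (-C)).continuousOn
      refine ⟨Metric.infDist u (-C), ?_, fun w hw => hmin hw⟩
      refine (hC_closed.neg.notMem_iff_infDist_pos hne).1 fun hu' => ?_
      have h2 : u ∈ C ∩ (-C) := ⟨hu.2, hu'⟩
      rw [hC_salient] at h2
      have h3 := hu.1
      rw [Set.mem_singleton_iff.1 h2] at h3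
      simp at h3
  refine ⟨d, hd, fun u hu v hv => ?_⟩
  by_cases hu0 : u = 0
  · simp [hu0]
  have hn : 0 < ‖u‖ := norm_pos_iff.2 hu0
  have h1 := hdK (‖u‖⁻¹ • u) ⟨by simp [norm_smul, hn.ne'], hC_smul _ (by positivity) u hu⟩
  have h2 : -(‖u‖⁻¹ • v) ∈ -C := by
    simpa using hC_smul ‖u‖⁻¹ (by positivity) v hv
  have h3 := h1.trans (Metric.infDist_le_dist_of_mem h2)
  rw [dist_eq_norm, sub_neg_eq_add, ← smul_add, norm_smul, norm_inv, norm_norm] at h3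
  rw [inv_mul_eq_div, le_div_iff₀ hn] at h3
  exact h3

/-- For `L` in the interior of a salient closed convex cone `C` spanning a
finite-dimensional real normed space `V`, there is `c > 0` such that every
linear endomorphism `T` with `T(C) ⊆ C` satisfies `‖T‖ ≤ c * ‖T L‖`. -/
theorem stmt3 (V : Type*) [NormedAddCommGroup V] [NormedSpace ℝ V]
    [FiniteDimensional ℝ V] (C : Set V)
    (hC_closed : IsClosed C)
    (hC_add : ∀ x ∈ C, ∀ y ∈ C, x + y ∈ C)
    (hC_smul : ∀ t : ℝ, 0 ≤ t → ∀ x ∈ C, t • x ∈ C)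
    (hC_salient : C ∩ (-C) = {0})
    (hC_span : Submodule.span ℝ C = ⊤)
    (L : V) (hL : L ∈ interior C) :
    ∃ c : ℝ, 0 < c ∧ ∀ T : V →L[ℝ] V, T '' C ⊆ C → ‖T‖ ≤ c * ‖T L‖ := by
  have h0 : (0 : V) ∈ C := by
    have : (0 : V) ∈ C ∩ (-C) := by rw [hC_salient]; rfl
    exact this.1
  obtain ⟨d, hd, hnorm⟩ := cone_normal_aux C hC_closed hC_smul hC_salient h0
  obtain ⟨r, hr, hball⟩ := Metric.nhds_basis_closedBall.mem_iff.1 (mem_interior_iff_mem_nhds.1 hL)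
  refine ⟨(2 / d + 1) / r, by positivity, fun T hT => ?_⟩
  have hTC : ∀ x ∈ C, T x ∈ C := fun x hx => hT ⟨x, hx, rfl⟩
  have key : ∀ x : V, ‖x‖ ≤ r → ‖T x‖ ≤ (2 / d + 1) * ‖T L‖ := by
    intro x hx
    have hp : L + x ∈ C := hball (by simpa using hx)
    have hm : L - x ∈ C := hball (by simpa [dist_eq_norm] using hx)
    have h := hnorm _ (hTC _ hp) _ (hTC _ hm)
    have e : T (L + x) + T (L - x) = (2 : ℝ) • T L := by
      rw [← map_add, ← map_smul]; congr 1; rw [two_smul]; abel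
    rw [e, norm_smul, Real.norm_ofNat, mul_comm, ← le_div_iff₀ hd] at h
    have e2 : T x = T (L + x) - T L := by simp
    calc ‖T x‖ ≤ ‖T (L + x)‖ + ‖T L‖ := by rw [e2]; exact norm_sub_le _ _
      _ ≤ 2 * ‖T L‖ / d + ‖T L‖ := by gcongr
      _ = _ := by ring
  refine T.opNorm_le_bound (by positivity) fun x => ?_
  by_cases hx : x = 0
  · simp [hx]
  have hn : 0 < ‖x‖ := norm_pos_iff.2 hx
  have h := key ((r / ‖x‖) • x) (by
    rw [norm_smul, norm_div, norm_norm, Real.norm_of_nonneg hr.le, div_mul_cancel₀ _ hn.ne'])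
  rw [map_smul, norm_smul, norm_div, norm_norm, Real.norm_of_nonneg hr.le] at h
  calc ‖T x‖ = (‖x‖ / r) * (r / ‖x‖ * ‖T x‖) := by field_simp
    _ ≤ (‖x‖ / r) * ((2 / d + 1) * ‖T L‖) := by gcongr
    _ = _ := by ring
end

section
/- Let f be an ℝ-linear endomorphism of a finite-dimensional real normed vector space V and let v ∈ V. If ‖f^m(v)‖/m → 0 as m → +∞ (i.e. ‖f^m(v)‖ = o(m)), then the sequence (‖f^m(v)‖)_{m∈ℕ} is bounded. -/
open Filter

section aux
open Asymptotics

variable {E : Type*} [NormedAddCommGroup E] [NormedSpace ℂ E]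

def auxW (F : E →ₗ[ℂ] E) : Submodule ℂ E where
  carrier := {w | (fun m : ℕ => (F ^ m) w) =o[atTop] (fun m : ℕ => (m : ℝ))}
  zero_mem' := by simp
  add_mem' := by
    intro a b ha hb
    simp only [Set.mem_setOf_eq, map_add] at *
    exact ha.add hb
  smul_mem' := by
    intro c a ha
    simp only [Set.mem_setOf_eq, map_smul] at *
    exact ha.const_smul_left c

def auxB (F : E →ₗ[ℂ] E) : Submodule ℂ E where
  carrier := {w | ∃ C : ℝ, ∀ m : ℕ, ‖(F ^ m) w‖ ≤ C}
  zero_mem' := ⟨0, by simp⟩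
  add_mem' := by
    rintro a b ⟨C, hC⟩ ⟨D, hD⟩
    refine ⟨C + D, fun m => ?_⟩
    rw [map_add]
    exact (norm_add_le _ _).trans (add_le_add (hC m) (hD m))
  smul_mem' := by
    rintro c a ⟨C, hC⟩
    refine ⟨‖c‖ * C, fun m => ?_⟩
    rw [map_smul, norm_smul]
    exact mul_le_mul_of_nonneg_left (hC m) (norm_nonneg _)

lemma auxW_map (F : E →ₗ[ℂ] E) (w : E) (hw : w ∈ auxW F) : F w ∈ auxW F := by
  change (fun m : ℕ => (F ^ m) w) =o[atTop] (fun m : ℕ => (m : ℝ)) at hw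
  change (fun m : ℕ => (F ^ m) (F w)) =o[atTop] (fun m : ℕ => (m : ℝ))
  have h1 := hw.comp_tendsto (tendsto_add_atTop_nat 1)
  have h2 : (fun m : ℕ => (F ^ m) (F w)) = (fun m : ℕ => (F ^ m) w) ∘ (fun m => m + 1) := by
    funext m
    simp [pow_succ]
  rw [h2]
  refine h1.trans_isBigO (IsBigO.of_bound 2 ?_)
  filter_upwards [eventually_ge_atTop 1] with m hm
  have : (1 : ℝ) ≤ m := by exact_mod_cast hm
  simp only [Function.comp, Real.norm_eq_abs]
  push_cast
  rw [abs_of_nonneg (by positivity), abs_of_nonneg (by positivity)]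
  linarith

lemma aux_lin (F : E →ₗ[ℂ] E) (μ : ℂ) (hμ : 1 ≤ ‖μ‖) (w u : E) (hw : w ∈ auxW F)
    (hu : F w = μ • w + u) (huu : F u = μ • u) : u = 0 := by
  have hp : ∀ m : ℕ, (F ^ m) u = μ ^ m • u := by
    intro m
    induction m with
    | zero => simp
    | succ m ih => rw [pow_succ', Module.End.mul_apply, ih, map_smul, huu, smul_smul, pow_succ]
  have hq : ∀ m : ℕ, μ • (F ^ m) w = μ ^ m • (μ • w + (m : ℂ) • u) := by
    intro m
    induction m with
    | zero => simp
    | succ m ih =>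
      rw [pow_succ', Module.End.mul_apply, ← map_smul, ih]
      simp only [map_smul, map_add, hu, huu]
      push_cast
      module
  change (fun m : ℕ => (F ^ m) w) =o[atTop] (fun m : ℕ => (m : ℝ)) at hw
  have h1 : (fun m : ℕ => μ • w + (m : ℂ) • u) =o[atTop] (fun m : ℕ => (m : ℝ)) := by
    refine IsBigO.trans_isLittleO (IsBigO.of_bound 1 (Eventually.of_forall fun m => ?_))
      (hw.const_smul_left μ)
    simp only [Pi.smul_apply]
    rw [hq, norm_smul, one_mul, norm_pow]
    exact le_mul_of_one_le_left (norm_nonneg _) (one_le_pow₀ hμ)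
  have h2 : (fun _ : ℕ => μ • w) =o[atTop] (fun m : ℕ => (m : ℝ)) := by
    rw [isLittleO_const_left]
    right
    exact tendsto_norm_atTop_atTop.comp tendsto_natCast_atTop_atTop
  have h3 : (fun m : ℕ => (m : ℂ) • u) =o[atTop] (fun m : ℕ => (m : ℝ)) := by
    simpa using h1.sub h2
  by_contra hne
  have hpos : 0 < ‖u‖ := norm_pos_iff.mpr hne
  have h4 := (h3.def (half_pos hpos)).and (eventually_ge_atTop 1)
  obtain ⟨m, hm, hm1⟩ := h4.exists
  have : (1 : ℝ) ≤ m := by exact_mod_cast hm1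
  rw [norm_smul] at hm
  simp at hm
  nlinarith

lemma aux_big (F : E →ₗ[ℂ] E) (μ : ℂ) (hμ : 1 ≤ ‖μ‖) (k : ℕ) : ∀ w ∈ auxW F,
    ((F - μ • (1 : Module.End ℂ E)) ^ k) w = 0 → F w = μ • w := by
  induction k with
  | zero => intro w _ h; simp at h; simp [h]
  | succ k ih =>
    intro w hw h
    rw [pow_succ, Module.End.mul_apply] at h
    have e : (F - μ • (1 : Module.End ℂ E)) w = F w - μ • w := by simp
    rw [e] at h
    have hu := ih _ ((auxW F).sub_mem (auxW_map F w hw) ((auxW F).smul_mem μ hw)) h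
    exact sub_eq_zero.mp (aux_lin F μ hμ w _ hw (by abel) hu)

lemma aux_small (F : E →ₗ[ℂ] E) (μ : ℂ) (hμ : ‖μ‖ < 1) (k : ℕ) : ∀ w,
    ((F - μ • (1 : Module.End ℂ E)) ^ k) w = 0 → w ∈ auxB F := by
  induction k with
  | zero => intro w h; simp at h; simp [h]
  | succ k ih =>
    intro w h
    rw [pow_succ, Module.End.mul_apply] at h
    have e : (F - μ • (1 : Module.End ℂ E)) w = F w - μ • w := by simp
    rw [e] at h
    obtain ⟨C, hC⟩ := ih _ h
    have h1 : 0 < 1 - ‖μ‖ := by linarith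
    refine ⟨max ‖w‖ (C / (1 - ‖μ‖)), fun m => ?_⟩
    induction m with
    | zero => simp
    | succ m ihm =>
      have h2 := hC m
      have h3 : (F ^ (m + 1)) w = μ • (F ^ m) w + (F ^ m) (F w - μ • w) := by
        rw [pow_succ, Module.End.mul_apply, map_sub, map_smul]; abel
      rw [h3]
      refine (norm_add_le _ _).trans ?_
      rw [norm_smul]
      have h4 := le_max_right ‖w‖ (C / (1 - ‖μ‖))
      rw [div_le_iff₀ h1] at h4
      have h5 := mul_le_mul_of_nonneg_left ihm (norm_nonneg μ)
      linarith

lemma aux_eig (F : E →ₗ[ℂ] E) (μ : ℂ) (w : E) (hw : w ∈ auxW F) (k : ℕ)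
    (h : ((F - μ • (1 : Module.End ℂ E)) ^ k) w = 0) : w ∈ auxB F := by
  rcases lt_or_ge ‖μ‖ 1 with h1 | h1
  · exact aux_small F μ h1 k w h
  have hF := aux_big F μ h1 k w hw h
  have hp : ∀ m : ℕ, (F ^ m) w = μ ^ m • w := by
    intro m
    induction m with
    | zero => simp
    | succ m ih => rw [pow_succ', Module.End.mul_apply, ih, map_smul, hF, smul_smul, pow_succ]
  rcases h1.eq_or_lt with h2 | h2
  · refine ⟨‖w‖, fun m => ?_⟩
    rw [hp, norm_smul, norm_pow, ← h2]; simp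
  · have : w = 0 := by
      have hne : μ - 1 ≠ 0 := by
        intro h0
        rw [sub_eq_zero.mp h0] at h2
        simp at h2
      change (fun m : ℕ => (F ^ m) w) =o[atTop] (fun m : ℕ => (m : ℝ)) at hw
      have h3 : (fun m : ℕ => (m : ℝ)) =o[atTop] (fun m : ℕ => ‖μ‖ ^ m) := by
        simpa using isLittleO_coe_const_pow_of_one_lt (R := ℝ) h2
      have h4 := (hw.trans h3)
      by_contra hne
      have hpos : 0 < ‖w‖ := norm_pos_iff.mpr hne
      obtain ⟨m, hm⟩ := (h4.def (half_pos hpos)).exists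
      rw [hp, norm_smul, norm_pow] at hm
      have : 0 < ‖μ‖ ^ m := by positivity
      simp at hm
      nlinarith
    rw [this]; exact zero_mem _

lemma aux_main [FiniteDimensional ℂ E] (F : E →ₗ[ℂ] E) : auxW F ≤ auxB F := by
  have h := Submodule.eq_iSup_inf_genEigenspace (p := auxW F) (f := F) ⊤
    (fun x hx => auxW_map F x hx) (Module.End.iSup_maxGenEigenspace_eq_top F)
  rw [h]
  refine iSup_le fun μ w hw => ?_
  obtain ⟨hw1, hw2⟩ := hw
  obtain ⟨k, hk⟩ := (Module.End.mem_maxGenEigenspace F μ w).mp hw2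
  exact aux_eig F μ w hw1 k hk

end aux

/-- The first step in the proof of Lemma 2.3 of the paper: if
`‖fᵐ(v)‖ = o(m)`, then the sequence `‖fᵐ(v)‖` is bounded. -/
theorem stmt8 (V : Type*) [NormedAddCommGroup V] [NormedSpace ℝ V]
    [FiniteDimensional ℝ V]
    (f : V →ₗ[ℝ] V) (v : V)
    (h : Tendsto (fun m : ℕ => ‖(f ^ m) v‖ / m) atTop (nhds 0)) :
    ∃ B : ℝ, ∀ m : ℕ, ‖(f ^ m) v‖ ≤ B := by
  let b := Module.finBasis ℝ V
  let A := LinearMap.toMatrix b b f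
  let F : (Fin (Module.finrank ℝ V) → ℂ) →ₗ[ℂ] (Fin (Module.finrank ℝ V) → ℂ) :=
    Matrix.toLin' (A.map (fun x : ℝ => (x : ℂ)))
  let J : V →ₗ[ℝ] (Fin (Module.finrank ℝ V) → ℂ) :=
    { toFun := fun x i => ((b.repr x i : ℝ) : ℂ)
      map_add' := by intro x y; ext i; simp
      map_smul' := by intro c x; ext i; simp }
  have hJ : ∀ x i, J x i = ((b.repr x i : ℝ) : ℂ) := fun _ _ => rfl
  have hinj : Function.Injective J := by
    intro x y hxy
    apply b.repr.injective
    ext i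
    have := congrFun hxy i
    rw [hJ, hJ] at this
    exact_mod_cast this
  have hcomm : ∀ x, J (f x) = F (J x) := by
    intro x
    ext i
    rw [hJ, ← LinearMap.toMatrix_mulVec_repr b b f x]
    simp only [F, Matrix.toLin'_apply, Matrix.mulVec, dotProduct, Matrix.map_apply, hJ]
    push_cast
    rfl
  have hpow : ∀ m x, J ((f ^ m) x) = (F ^ m) (J x) := by
    intro m
    induction m with
    | zero => simp
    | succ m ih => intro x; rw [pow_succ, pow_succ, Module.End.mul_apply, Module.End.mul_apply, ih, hcomm]
  obtain ⟨K, _, hK⟩ := J.exists_antilipschitzWith (LinearMap.ker_eq_bot.mpr hinj)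
  have hW : J v ∈ auxW F := by
    change (fun m : ℕ => (F ^ m) (J v)) =o[atTop] (fun m : ℕ => (m : ℝ))
    have h1 : (fun m : ℕ => (f ^ m) v) =o[atTop] (fun m : ℕ => (m : ℝ)) := by
      rw [← Asymptotics.isLittleO_norm_left, Asymptotics.isLittleO_iff_tendsto']
      · exact h
      · filter_upwards [eventually_ge_atTop 1] with m hm h0
        have : m = 0 := by exact_mod_cast h0
        omega
    refine Asymptotics.IsBigO.trans_isLittleO
      (Asymptotics.IsBigO.of_bound ‖J.toContinuousLinearMap‖ (Eventually.of_forall fun m => ?_)) h1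
    rw [← hpow]
    exact J.toContinuousLinearMap.le_opNorm _
  obtain ⟨C, hC⟩ := aux_main F hW
  refine ⟨K * C, fun m => ?_⟩
  have h1 := hK.le_mul_dist ((f ^ m) v) 0
  rw [map_zero, dist_zero_right, dist_zero_right, hpow] at h1
  exact h1.trans (mul_le_mul_of_nonneg_left (hC m) K.2)
end

section
/- Let C = {(x, y) ∈ ℝ² : x ≥ 0 and y ≥ 0} and let G be the set of all invertible 2×2 real matrices (a_{ij}) with nonnegative entries which are either diagonal (a₁₂ = a₂₁ = 0) or anti-diagonal (a₁₁ = a₂₂ = 0). Then G is a subgroup of GL(2, ℝ), G is solvable, every element of G maps C into C, and yet there is no nonzero vector v ∈ C that is a common eigenvector of all elements of G. -/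
/-- Membership predicate. -/
def stmt9P (m : Matrix (Fin 2) (Fin 2) ℝ) : Prop :=
  (∀ i j : Fin 2, 0 ≤ m i j) ∧ ((m 0 1 = 0 ∧ m 1 0 = 0) ∨ (m 0 0 = 0 ∧ m 1 1 = 0))

theorem stmt9P_mul {a b : Matrix (Fin 2) (Fin 2) ℝ} (ha : stmt9P a) (hb : stmt9P b) :
    stmt9P (a * b) := by
  obtain ⟨ha, ha'⟩ := ha
  obtain ⟨hb, hb'⟩ := hb
  refine ⟨fun i j => ?_, ?_⟩
  · rw [Matrix.mul_apply]
    exact Finset.sum_nonneg fun k _ => mul_nonneg (ha _ _) (hb _ _)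
  · simp only [Matrix.mul_apply, Fin.sum_univ_two]
    rcases ha' with ⟨h1, h2⟩ | ⟨h1, h2⟩ <;> rcases hb' with ⟨h3, h4⟩ | ⟨h3, h4⟩ <;>
      simp [h1, h2, h3, h4]

theorem stmt9P_inv {a : Matrix (Fin 2) (Fin 2) ℝ} (ha : stmt9P a) :
    stmt9P a⁻¹ := by
  obtain ⟨ha, ha'⟩ := ha
  have h00 := ha 0 0
  have h01 := ha 0 1
  have h10 := ha 1 0
  have h11 := ha 1 1
  rw [Matrix.inv_def, Matrix.adjugate_fin_two, Matrix.det_fin_two, Ring.inverse_eq_inv']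
  rcases ha' with ⟨h1, h2⟩ | ⟨h1, h2⟩
  · refine ⟨fun i j => ?_, Or.inl ?_⟩
    · fin_cases i <;> fin_cases j <;> simp [h1, h2] <;> positivity
    · simp [h1, h2]
  · refine ⟨fun i j => ?_, Or.inr ?_⟩
    · fin_cases i <;> fin_cases j <;> simp [h1, h2] <;> positivity
    · simp [h1, h2]

/-- The group. -/
def stmt9G : Subgroup (Matrix.GeneralLinearGroup (Fin 2) ℝ) where
  carrier := {g | stmt9P (g : Matrix (Fin 2) (Fin 2) ℝ)}
  mul_mem' := fun {a b} ha hb => by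
    simpa using stmt9P_mul ha hb
  one_mem' := by
    refine ⟨fun i j => ?_, Or.inl ?_⟩
    · fin_cases i <;> fin_cases j <;> simp
    · simp
  inv_mem' := fun {a} ha => by
    have := stmt9P_inv ha
    simpa [Matrix.coe_units_inv] using this

theorem stmt9_diag {a : Matrix (Fin 2) (Fin 2) ℝ} (ha : stmt9P a) (h : a.det = 1) :
    a 0 1 = 0 ∧ a 1 0 = 0 := by
  obtain ⟨ha, h' | ⟨h1, h2⟩⟩ := ha
  · exact h'
  · rw [Matrix.det_fin_two, h1, h2] at h
    nlinarith [mul_nonneg (ha 0 1) (ha 1 0)]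

theorem stmt9_solv : IsSolvable stmt9G := by
  let f : stmt9G →* ℝˣ := Matrix.GeneralLinearGroup.det.comp stmt9G.subtype
  have hc : ∀ a b : f.ker, a * b = b * a := by
    rintro ⟨⟨a, ha⟩, ha1⟩ ⟨⟨b, hb⟩, hb1⟩
    have ha2 : (a : Matrix (Fin 2) (Fin 2) ℝ).det = 1 := congrArg Units.val ha1
    have hb2 : (b : Matrix (Fin 2) (Fin 2) ℝ).det = 1 := congrArg Units.val hb1
    obtain ⟨h1, h2⟩ := stmt9_diag ha ha2
    obtain ⟨h3, h4⟩ := stmt9_diag hb hb2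
    apply Subtype.ext
    apply Subtype.ext
    apply Units.ext
    change (a : Matrix (Fin 2) (Fin 2) ℝ) * b = b * a
    ext i j
    fin_cases i <;> fin_cases j <;>
      simp [Matrix.mul_apply, Fin.sum_univ_two, h1, h2, h3, h4, mul_comm]
  have : Group.IsSolvable f.ker := Group.isSolvable_of_comm hc
  exact Group.isSolvable_of_ker_le_range f.ker.subtype f (by simp)

/-- The example in Remark 3.8 of the paper. The set of invertible `2×2` real
matrices with nonnegative entries which are diagonal or anti-diagonal forms a
solvable subgroup of `GL(2, ℝ)` preserving the cone
`C = {(x, y) : x ≥ 0, y ≥ 0}`, yet it admits no common eigenvector in `C`. -/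
theorem stmt9 :
    ∃ G : Subgroup (Matrix.GeneralLinearGroup (Fin 2) ℝ),
      (∀ g : Matrix.GeneralLinearGroup (Fin 2) ℝ,
        g ∈ G ↔ ((∀ i j : Fin 2, 0 ≤ (g : Matrix (Fin 2) (Fin 2) ℝ) i j) ∧
          (((g : Matrix (Fin 2) (Fin 2) ℝ) 0 1 = 0 ∧
            (g : Matrix (Fin 2) (Fin 2) ℝ) 1 0 = 0) ∨
           ((g : Matrix (Fin 2) (Fin 2) ℝ) 0 0 = 0 ∧
            (g : Matrix (Fin 2) (Fin 2) ℝ) 1 1 = 0)))) ∧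
      IsSolvable G ∧
      (∀ g ∈ G, ∀ v : Fin 2 → ℝ, 0 ≤ v 0 → 0 ≤ v 1 →
        0 ≤ ((g : Matrix (Fin 2) (Fin 2) ℝ).mulVec v) 0 ∧
        0 ≤ ((g : Matrix (Fin 2) (Fin 2) ℝ).mulVec v) 1) ∧
      ¬ ∃ v : Fin 2 → ℝ, v ≠ 0 ∧ 0 ≤ v 0 ∧ 0 ≤ v 1 ∧
          ∀ g ∈ G, ∃ lam : ℝ, (g : Matrix (Fin 2) (Fin 2) ℝ).mulVec v = lam • v := by
  refine ⟨stmt9G, fun g => Iff.rfl, stmt9_solv, ?_, ?_⟩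
  · rintro g ⟨hg, -⟩ v h0 h1
    simp only [Matrix.mulVec, dotProduct, Fin.sum_univ_two]
    exact ⟨add_nonneg (mul_nonneg (hg _ _) h0) (mul_nonneg (hg _ _) h1),
      add_nonneg (mul_nonneg (hg _ _) h0) (mul_nonneg (hg _ _) h1)⟩
  · rintro ⟨v, hv, h0, h1, h⟩
    obtain ⟨l, hl⟩ := h (Matrix.GeneralLinearGroup.mkOfDetNeZero !![0, 1; 1, 0] (by simp)) (by
      refine ⟨fun i j => ?_, Or.inr ?_⟩
      · fin_cases i <;> fin_cases j <;> simp [Matrix.GeneralLinearGroup.mkOfDetNeZero]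
      · simp [Matrix.GeneralLinearGroup.mkOfDetNeZero])
    obtain ⟨k, hk⟩ := h (Matrix.GeneralLinearGroup.mkOfDetNeZero !![1, 0; 0, 2] (by simp)) (by
      refine ⟨fun i j => ?_, Or.inl ?_⟩
      · fin_cases i <;> fin_cases j <;> simp [Matrix.GeneralLinearGroup.mkOfDetNeZero]
      · simp [Matrix.GeneralLinearGroup.mkOfDetNeZero])
    have e1 := congrFun hl 0
    have e2 := congrFun hl 1
    have e3 := congrFun hk 0
    have e4 := congrFun hk 1
    simp [Matrix.GeneralLinearGroup.mkOfDetNeZero, Matrix.mulVec, dotProduct,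
      Fin.sum_univ_two] at e1 e2 e3 e4
    have hz : v 0 * v 1 = 0 := by
      rcases e4 with e4 | e4
      · subst e4
        linear_combination - v 1 * e3
      · rw [e4, mul_zero]
    apply hv
    have : v 0 = 0 ∧ v 1 = 0 := by
      rcases mul_eq_zero.1 hz with h | h
      · exact ⟨h, by rw [e1, h, mul_zero]⟩
      · exact ⟨by rw [e2, h, mul_zero], h⟩
    ext i
    fin_cases i
    · exact this.1
    · exact this.2
end
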